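/- arXiv:1101.1408 — 5 statements merged into one kernel-verified Lean document; each statement's English description precedes it below -/
import Mathlib

section
/- Let 𝔽 be a finite field with q elements, q odd, ψ : 𝔽 → ℂ a nontrivial additive character, V a finite-dimensional 𝔽-vector space, B : V × V → 𝔽 a symmetric bilinear form with radical V₀, and φ : V → 𝔽 a linear functional. If φ does not vanish identically on V₀, then ∑_{v ∈ V} ψ(B(v,v) + φ(v)) = 0. -/
open scoped BigOperators

/-- Let `𝔽` be a finite field of odd cardinality, `ψ` a nontrivial additive character of `𝔽`
with values in `ℂ`, `V` a finite-dimensional `𝔽`-vector space, `B` a symmetric bilinear form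
on `V` with radical `V₀ = {v | ∀ w, B v w = 0}`, and `φ` a linear functional on `V`.
If `φ` does not vanish identically on `V₀`, then `∑ v, ψ (B v v + φ v) = 0`. -/
theorem gauss_sum_vanishes_of_functional_nonzero_on_radical
    {𝔽 : Type*} [Field 𝔽] [Fintype 𝔽] (hq : Odd (Fintype.card 𝔽))
    (ψ : AddChar 𝔽 ℂ) (hψ : ψ ≠ 1)
    {V : Type*} [AddCommGroup V] [Module 𝔽 V] [FiniteDimensional 𝔽 V] [Fintype V]
    (B : V →ₗ[𝔽] V →ₗ[𝔽] 𝔽) (hB : ∀ v w, B v w = B w v)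
    (φ : V →ₗ[𝔽] 𝔽) (hφ : ∃ v : V, (∀ w : V, B v w = 0) ∧ φ v ≠ 0) :
    ∑ v : V, ψ (B v v + φ v) = 0 := by
  obtain ⟨u, hu, hφu⟩ := hφ
  obtain ⟨a, ha⟩ : ∃ a, ψ a ≠ 1 := by
    by_contra h
    push Not at h
    exact hψ (by ext a; simpa using h a)
  -- translate by a radical vector `w` with `φ w = a`
  set w : V := (a / φ u) • u with hw
  have hBw : ∀ v, B w v = 0 := fun v => by simp [hw, hu v]
  have hφw : φ w = a := by
    simp only [hw, map_smul, smul_eq_mul]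
    exact div_mul_cancel₀ a hφu
  have key : ∑ v : V, ψ (B v v + φ v) = ψ a * ∑ v : V, ψ (B v v + φ v) := by
    rw [Finset.mul_sum, ← Equiv.sum_comp (Equiv.addRight w)]
    refine Finset.sum_congr rfl fun v _ => ?_
    rw [← AddChar.map_add_eq_mul]
    congr 1
    simp only [Equiv.coe_addRight, map_add, LinearMap.add_apply, hBw, hB v w, hφw]
    ring
  have h2 : (ψ a - 1) * ∑ v : V, ψ (B v v + φ v) = 0 := by
    rw [sub_mul, one_mul, ← key, sub_self]
  exact (mul_eq_zero.mp h2).resolve_left (sub_ne_zero.mpr ha)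
end

section
/- Let 𝔽 be a finite field with q elements, q odd, ψ : 𝔽 → ℂ a nontrivial additive character, V a finite-dimensional 𝔽-vector space, and B : V × V → 𝔽 a symmetric bilinear form such that the induced linear map b : V → V*, b(v) = B(v,·), is bijective. Then for every linear functional φ : V → 𝔽, ∑_{v ∈ V} ψ(B(v,v) + φ(v)) = ψ(−4⁻¹·φ(b⁻¹(φ))) · ∑_{w ∈ V} ψ(B(w,w)), where 4⁻¹ denotes the inverse of 4 in 𝔽. -/
open scoped BigOperators

/-- Let `𝔽` be a finite field of odd cardinality, `ψ` a nontrivial additive character of `𝔽`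
with values in `ℂ`, `V` a finite-dimensional `𝔽`-vector space, and `B` a symmetric bilinear
form on `V` such that the induced map `b : V → V*`, `v ↦ B v ·`, is bijective.  Then for
every linear functional `φ`,
`∑ v, ψ (B v v + φ v) = ψ (-(4⁻¹ * φ (b⁻¹ φ))) * ∑ w, ψ (B w w)`. -/
theorem gauss_sum_completion_of_square
    {𝔽 : Type*} [Field 𝔽] [Fintype 𝔽] (hq : Odd (Fintype.card 𝔽))
    (ψ : AddChar 𝔽 ℂ) (hψ : ψ ≠ 1)
    {V : Type*} [AddCommGroup V] [Module 𝔽 V] [FiniteDimensional 𝔽 V] [Fintype V]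
    (B : V →ₗ[𝔽] V →ₗ[𝔽] 𝔽) (hB : ∀ v w, B v w = B w v)
    (hb : Function.Bijective B) (φ : V →ₗ[𝔽] 𝔽) :
    ∑ v : V, ψ (B v v + φ v) =
      ψ (-((4 : 𝔽)⁻¹ * φ ((LinearEquiv.ofBijective B hb).symm φ))) *
        ∑ w : V, ψ (B w w) := by
  have h2 : (2 : 𝔽) ≠ 0 := by
    apply Ring.two_ne_zero
    intro h
    have h1 := FiniteField.even_card_of_char_two h
    have h3 := Nat.odd_iff.mp hq
    omega
  have h4 : (4 : 𝔽) ≠ 0 := by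
    have h : (4 : 𝔽) = 2 * 2 := by norm_num
    rw [h]
    exact mul_ne_zero h2 h2
  obtain ⟨u, hu⟩ : ∃ u, (LinearEquiv.ofBijective B hb).symm φ = u := ⟨_, rfl⟩
  have hφ : φ = B u := by
    rw [← hu]
    exact ((LinearEquiv.ofBijective B hb).apply_symm_apply φ).symm
  rw [hu, Finset.mul_sum, hφ]
  refine Fintype.sum_equiv (Equiv.addRight ((2 : 𝔽)⁻¹ • u)) _ _ fun v => ?_
  rw [← AddChar.map_add_eq_mul]
  congr 1
  simp only [Equiv.coe_addRight, map_add, map_smul, LinearMap.add_apply, LinearMap.smul_apply,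
    smul_eq_mul, hB v u]
  field_simp
  ring
end

section
/- For all integers n, m, a with n ≥ 4, 0 ≤ m ≤ n and m ≤ a, one has −3m² + m(4n−1) − 6 ≤ 2a(2n−3−m); moreover equality holds if and only if a = m and m ∈ {2, 3}. -/
/-- For all integers `n, m, a` with `n ≥ 4`, `0 ≤ m ≤ n` and `m ≤ a`, one has
`-3m² + m(4n-1) - 6 ≤ 2a(2n-3-m)`, with equality iff `a = m` and `m ∈ {2, 3}`. -/
theorem shatz_codim_inequality (n m a : ℤ)
    (hn : 4 ≤ n) (hm0 : 0 ≤ m) (hmn : m ≤ n) (hma : m ≤ a) :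
    -3 * m ^ 2 + m * (4 * n - 1) - 6 ≤ 2 * a * (2 * n - 3 - m) ∧
    (-3 * m ^ 2 + m * (4 * n - 1) - 6 = 2 * a * (2 * n - 3 - m) ↔
      a = m ∧ (m = 2 ∨ m = 3)) := by
  have key : 2 * a * (2 * n - 3 - m) - (-3 * m ^ 2 + m * (4 * n - 1) - 6)
      = 2 * ((a - m) * (2 * n - 3 - m)) + (m - 2) * (m - 3) := by ring
  have hpos : 0 < 2 * n - 3 - m := by omega
  have h1 : 0 ≤ (a - m) * (2 * n - 3 - m) := mul_nonneg (by omega) hpos.le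
  have h2 : 0 ≤ (m - 2) * (m - 3) := by
    rcases le_or_gt m 2 with h | h
    · exact mul_nonneg_of_nonpos_of_nonpos (by omega) (by omega)
    · exact mul_nonneg (by omega) (by omega)
  refine ⟨by linarith, ⟨fun h => ?_, ?_⟩⟩
  · have e1 : (a - m) * (2 * n - 3 - m) = 0 := by linarith
    have e2 : (m - 2) * (m - 3) = 0 := by linarith
    rcases mul_eq_zero.mp e1 with h3 | h3
    · rcases mul_eq_zero.mp e2 with h4 | h4
      · exact ⟨by omega, Or.inl (by omega)⟩
      · exact ⟨by omega, Or.inr (by omega)⟩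
    · omega
  · rintro ⟨rfl, rfl | rfl⟩ <;> ring
end

section
/- For all integers n, m, a with n ≥ 4, 0 ≤ m ≤ n and m ≤ a, one has 2a − 3 ≤ −4nm + m(2m+1) + m² + (2n−2m)(m+a) + m(m−1)/2 + (m−1)a, where m(m−1)/2 denotes the integer m(m−1)/2 (the product m(m−1) is even); moreover equality holds if and only if a = m and m ∈ {2, 3}. -/
/-- For all integers `n, m, a` with `n ≥ 4`, `0 ≤ m ≤ n` and `m ≤ a`, one has
`2a - 3 ≤ -4nm + m(2m+1) + m² + (2n-2m)(m+a) + m(m-1)/2 + (m-1)a`, with equality iff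
`a = m` and `m ∈ {2, 3}`.  Here `m(m-1)/2` is the (exact) integer quotient. -/
theorem shatz_codim_inequality' (n m a : ℤ)
    (hn : 4 ≤ n) (hm0 : 0 ≤ m) (hmn : m ≤ n) (hma : m ≤ a) :
    2 * a - 3 ≤
      -4 * n * m + m * (2 * m + 1) + m ^ 2 + (2 * n - 2 * m) * (m + a)
        + m * (m - 1) / 2 + (m - 1) * a ∧
    (2 * a - 3 =
      -4 * n * m + m * (2 * m + 1) + m ^ 2 + (2 * n - 2 * m) * (m + a)
        + m * (m - 1) / 2 + (m - 1) * a ↔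
      a = m ∧ (m = 2 ∨ m = 3)) := by
  obtain ⟨T, hT⟩ : ∃ T, m * (m - 1) = 2 * T :=
    (Int.even_mul_pred_self m).two_dvd
  have hdiv : m * (m - 1) / 2 = T := by rw [hT]; simp
  rw [hdiv]
  have hkey : (-4 * n * m + m * (2 * m + 1) + m ^ 2 + (2 * n - 2 * m) * (m + a)
        + T + (m - 1) * a) - (2 * a - 3) = (T - 2 * m + 3) + (2 * n - m - 3) * (a - m) := by
    ring
  have hq : 2 * (T - 2 * m + 3) = (m - 2) * (m - 3) := by linear_combination -hT
  have hq0 : 0 ≤ (m - 2) * (m - 3) := by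
    rcases le_or_gt m 2 with h | h
    · exact mul_nonneg_of_nonpos_of_nonpos (by omega) (by omega)
    · exact mul_nonneg (by omega) (by omega)
  have hd : 0 ≤ (2 * n - m - 3) * (a - m) := mul_nonneg (by omega) (by omega)
  refine ⟨by linarith, ⟨fun h => ?_, fun ⟨h1, h2⟩ => ?_⟩⟩
  · have e1 : (2 * n - m - 3) * (a - m) = 0 := by linarith
    have e2 : (m - 2) * (m - 3) = 0 := by linarith
    rcases mul_eq_zero.mp e1 with h1 | h1
    · omega
    · rcases mul_eq_zero.mp e2 with h2 | h2 <;> omega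
  · have e1 : (2 * n - m - 3) * (a - m) = 0 := by rw [h1]; ring
    have e2 : (m - 2) * (m - 3) = 0 := by rcases h2 with h2 | h2 <;> rw [h2] <;> norm_num
    linarith
end

section
/- Let k be a field of characteristic different from 2 and V a finite-dimensional k-vector space. An element ω of the second exterior power ⋀²V is decomposable, i.e. ω = v ∧ w for some v, w ∈ V, if and only if ω ∧ ω = 0 in ⋀⁴V. -/
open ExteriorAlgebra

section Helpers

variable {k : Type*} [Field k] {V : Type*} [AddCommGroup V] [Module k V]

/-- Contraction of an element of the exterior algebra by a linear form. -/
noncomputable def dcContr (d : Module.Dual k V) : ExteriorAlgebra k V →ₗ[k] ExteriorAlgebra k V :=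
  CliffordAlgebra.contractLeft (Q := (0 : QuadraticForm k V)) d

lemma dcContr_ι (d : Module.Dual k V) (v : V) :
    dcContr d (ExteriorAlgebra.ι k v) = algebraMap k _ (d v) :=
  CliffordAlgebra.contractLeft_ι (Q := (0 : QuadraticForm k V)) d v

lemma dcContr_ι_mul (d : Module.Dual k V) (v : V) (x : ExteriorAlgebra k V) :
    dcContr d (ExteriorAlgebra.ι k v * x) = d v • x - ExteriorAlgebra.ι k v * dcContr d x :=
  CliffordAlgebra.contractLeft_ι_mul (Q := (0 : QuadraticForm k V)) d v x

lemma dc_swap (v w : V) :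
    ExteriorAlgebra.ι k w * ExteriorAlgebra.ι k v
      = - (ExteriorAlgebra.ι k v * ExteriorAlgebra.ι k w) :=
  eq_neg_of_add_eq_zero_left (ExteriorAlgebra.ι_add_mul_swap w v)

lemma dc_ind {C : ExteriorAlgebra k V → Prop} {ω : ExteriorAlgebra k V}
    (hω : ω ∈ (LinearMap.range (ExteriorAlgebra.ι k : V →ₗ[k] ExteriorAlgebra k V)) ^ 2)
    (h1 : ∀ v w : V, C (ExteriorAlgebra.ι k v * ExteriorAlgebra.ι k w))
    (h2 : ∀ x y, C x → C y → C (x + y)) : C ω := by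
  rw [pow_two] at hω
  refine Submodule.mul_induction_on hω ?_ h2
  rintro _ ⟨v, rfl⟩ _ ⟨w, rfl⟩
  exact h1 v w

lemma dcContr_ι_mul_ι (d : Module.Dual k V) (v w : V) :
    dcContr d (ExteriorAlgebra.ι k v * ExteriorAlgebra.ι k w)
      = d v • ExteriorAlgebra.ι k w - d w • ExteriorAlgebra.ι k v := by
  rw [dcContr_ι_mul, dcContr_ι, ← Algebra.commutes, ← Algebra.smul_def]

lemma dcContr_deg2 (d : Module.Dual k V) {ω : ExteriorAlgebra k V}
    (hω : ω ∈ (LinearMap.range (ExteriorAlgebra.ι k : V →ₗ[k] ExteriorAlgebra k V)) ^ 2) :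
    ∃ u : V, dcContr d ω = ExteriorAlgebra.ι k u := by
  refine dc_ind (C := fun ω => ∃ u : V, dcContr d ω = ExteriorAlgebra.ι k u) hω
    (fun v w => ⟨d v • w - d w • v, ?_⟩) ?_
  · rw [dcContr_ι_mul_ι]; simp
  · rintro x y ⟨a, ha⟩ ⟨b, hb⟩
    exact ⟨a + b, by simp [ha, hb]⟩

lemma dcContr_mul (d : Module.Dual k V) {ω : ExteriorAlgebra k V}
    (hω : ω ∈ (LinearMap.range (ExteriorAlgebra.ι k : V →ₗ[k] ExteriorAlgebra k V)) ^ 2)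
    (x : ExteriorAlgebra k V) :
    dcContr d (ω * x) = dcContr d ω * x + ω * dcContr d x := by
  refine dc_ind (C := fun ω => dcContr d (ω * x) = dcContr d ω * x + ω * dcContr d x)
    hω (fun v w => ?_) ?_
  · rw [dcContr_ι_mul_ι, mul_assoc, dcContr_ι_mul, dcContr_ι_mul]
    simp only [sub_mul, mul_sub, smul_mul_assoc, mul_smul_comm, mul_assoc]
    abel
  · intro a b ha hb
    simp only [add_mul, map_add, ha, hb]
    abel

lemma dc_comm (u : V) {ω : ExteriorAlgebra k V}
    (hω : ω ∈ (LinearMap.range (ExteriorAlgebra.ι k : V →ₗ[k] ExteriorAlgebra k V)) ^ 2) :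
    ω * ExteriorAlgebra.ι k u = ExteriorAlgebra.ι k u * ω := by
  refine dc_ind
    (C := fun ω => ω * ExteriorAlgebra.ι k u = ExteriorAlgebra.ι k u * ω)
    hω (fun v w => ?_) ?_
  · rw [mul_assoc, dc_swap u w, mul_neg, ← mul_assoc, dc_swap u v, neg_mul, neg_neg, mul_assoc]
  · intro a b ha hb
    rw [add_mul, mul_add, ha, hb]

lemma dc_euler [FiniteDimensional k V] {ω : ExteriorAlgebra k V}
    (hω : ω ∈ (LinearMap.range (ExteriorAlgebra.ι k : V →ₗ[k] ExteriorAlgebra k V)) ^ 2) :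
    ∑ i, ExteriorAlgebra.ι k (Module.finBasis k V i) *
      dcContr ((Module.finBasis k V).coord i) ω = (2 : k) • ω := by
  refine dc_ind (C := fun ω => ∑ i, ExteriorAlgebra.ι k (Module.finBasis k V i) *
      dcContr ((Module.finBasis k V).coord i) ω = (2 : k) • ω) hω (fun v w => ?_) ?_
  · have key : ∀ v : V, ∑ i, (Module.finBasis k V).coord i v •
        ExteriorAlgebra.ι k (Module.finBasis k V i) = ExteriorAlgebra.ι k v := by
      intro v
      conv_rhs => rw [← (Module.finBasis k V).sum_repr v]
      simp only [map_sum, map_smul, Module.Basis.coord_apply]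
    simp only [dcContr_ι_mul_ι, mul_sub, mul_smul_comm, Finset.sum_sub_distrib]
    simp only [← smul_mul_assoc, ← Finset.sum_mul, key]
    rw [dc_swap v w, two_smul, sub_neg_eq_add, add_mul]
  · intro a b ha hb
    simp only [map_add, mul_add, Finset.sum_add_distrib, ha, hb, smul_add]

end Helpers

/-- Let `k` be a field of characteristic different from 2 and `V` a finite-dimensional
`k`-vector space.  An element `ω` of the second exterior power (the degree-2 part of the
exterior algebra) is decomposable, i.e. `ω = v ∧ w` for some `v, w ∈ V`, iff `ω ∧ ω = 0`. -/
theorem decomposable_iff_wedge_self_eq_zero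
    {k : Type*} [Field k] (h2 : (2 : k) ≠ 0)
    {V : Type*} [AddCommGroup V] [Module k V] [FiniteDimensional k V]
    (ω : ExteriorAlgebra k V)
    (hω : ω ∈ (LinearMap.range (ExteriorAlgebra.ι k : V →ₗ[k] ExteriorAlgebra k V)) ^ 2) :
    (∃ v w : V, ω = ExteriorAlgebra.ι k v * ExteriorAlgebra.ι k w) ↔ ω * ω = 0 := by
  constructor
  · rintro ⟨v, w, rfl⟩
    rw [← mul_assoc, dc_comm v hω, ← mul_assoc, ExteriorAlgebra.ι_sq_zero, zero_mul, zero_mul]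
  · intro h0
    choose u hu using fun d : Module.Dual k V => dcContr_deg2 d hω
    have h1 : ∀ d, ExteriorAlgebra.ι k (u d) * ω = 0 := by
      intro d
      have h := dcContr_mul d hω ω
      rw [h0, map_zero, hu, dc_comm _ hω, ← two_smul k] at h
      exact (smul_eq_zero.mp h.symm).resolve_left h2
    have h3 : ∀ d e : Module.Dual k V,
        e (u d) • ω = ExteriorAlgebra.ι k (u d) * ExteriorAlgebra.ι k (u e) := by
      intro d e
      have h := dcContr_ι_mul e (u d) ω
      rw [h1, map_zero, hu] at h
      exact sub_eq_zero.mp h.symm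
    by_cases hne : ∃ d e : Module.Dual k V, e (u d) ≠ 0
    · obtain ⟨d, e, hde⟩ := hne
      refine ⟨(e (u d))⁻¹ • u d, u e, ?_⟩
      rw [map_smul, smul_mul_assoc, ← h3, smul_smul, inv_mul_cancel₀ hde, one_smul]
    · push Not at hne
      have hz : ∀ d, u d = 0 := fun d =>
        (Module.forall_dual_apply_eq_zero_iff k (u d)).mp (hne d)
      have h := dc_euler hω
      simp only [hu, hz, map_zero, mul_zero, Finset.sum_const_zero] at h
      have hw : ω = 0 := (smul_eq_zero.mp h.symm).resolve_left h2
      exact ⟨0, 0, by simp [hw]⟩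
end
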